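/- Let A(τ), τ ∈ [0,1], be a continuous family of n×n complex matrices each having no eigenvalues on the imaginary axis. Then the dimension of the sum of generalized eigenspaces corresponding to eigenvalues with positive real part is independent of τ (the positive spectral subspace has locally constant dimension). -/

import Mathlib

open Filter Topology Polynomial

theorem iSupIndep.finrank_biSup_finset {ι K V : Type*} [Field K] [AddCommGroup V] [Module K V]
    [FiniteDimensional K V] {p : ι → Submodule K V} (hp : iSupIndep p) (s : Finset ι) :
    Module.finrank K ↥(⨆ i ∈ s, p i) = ∑ i ∈ s, Module.finrank K (p i) := by
  classical
  induction s using Finset.induction_on with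
  | empty => simp
  | insert a s ha ih =>
    have hd : Disjoint (p a) (⨆ i ∈ s, p i) := by
      simpa using hp.disjoint_biSup (y := (s : Set ι)) (by simpa using ha)
    have h := Submodule.finrank_sup_add_finrank_inf_eq (p a) (⨆ i ∈ s, p i)
    rw [hd.eq_bot, finrank_bot, add_zero, ih] at h
    rw [Finset.iSup_insert, h, Finset.sum_insert ha]

open scoped Classical in
/-- The dimension of a sum of generalized eigenspaces is the number of roots of the characteristic
polynomial in the corresponding set, counted with multiplicity. -/
theorem Module.End.finrank_biSup_maxGenEigenspace {K V : Type*} [Field K] [AddCommGroup V]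
    [Module K V] [FiniteDimensional K V] (f : Module.End K V) (S : Set K) :
    Module.finrank K ↥(⨆ μ ∈ S, f.maxGenEigenspace μ) =
      (f.charpoly.roots.filter (· ∈ S)).card := by
  have hsup : ⨆ μ ∈ S, f.maxGenEigenspace μ =
      ⨆ μ ∈ (f.charpoly.roots.filter (· ∈ S)).toFinset, f.maxGenEigenspace μ := by
    refine le_antisymm (iSup₂_le fun μ hμ => ?_) (iSup₂_le fun μ hμ => ?_)
    · by_cases hr : μ ∈ f.charpoly.roots
      · exact le_iSup₂_of_le μ (Multiset.mem_toFinset.2 (Multiset.mem_filter.2 ⟨hr, hμ⟩)) le_rfl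
      · have h0 := LinearMap.finrank_maxGenEigenspace_eq f μ
        rw [← count_roots, Multiset.count_eq_zero_of_notMem hr, Submodule.finrank_eq_zero] at h0
        simp [h0]
    · exact le_iSup₂_of_le μ (Multiset.mem_filter.1 (Multiset.mem_toFinset.1 hμ)).2 le_rfl
  rw [hsup, f.independent_maxGenEigenspace.finrank_biSup_finset, ← Multiset.toFinset_sum_count_eq]
  refine Finset.sum_congr rfl fun μ hμ => ?_
  rw [LinearMap.finrank_maxGenEigenspace_eq, Multiset.count_filter_of_pos, count_roots]
  exact (Multiset.mem_filter.1 (Multiset.mem_toFinset.1 hμ)).2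

theorem Matrix.exists_charpoly_roots_eq_map {n : ℕ} {K : Type*} [Field K] [IsAlgClosed K]
    (A : Matrix (Fin n) (Fin n) K) :
    ∃ r : Fin n → K, A.charpoly.roots = Finset.univ.val.map r := by
  have hcard : A.charpoly.roots.toList.length = n := by
    rw [Multiset.length_toList, splits_iff_card_roots.1 (IsAlgClosed.splits _),
      A.charpoly_natDegree_eq_dim, Fintype.card_fin]
  refine ⟨fun i => A.charpoly.roots.toList.get (i.cast hcard.symm), ?_⟩
  rw [Fin.univ_val_map]
  refine (Multiset.coe_toList _).symm.trans (congrArg _ ?_)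
  refine List.ext_get (by simpa using hcard) fun i h₁ h₂ => by simp

theorem Matrix.exists_norm_root_charpoly_le {n : ℕ} {A : ℕ → Matrix (Fin n) (Fin n) ℂ}
    {B : Matrix (Fin n) (Fin n) ℂ} (hA : Tendsto A atTop (𝓝 B)) :
    ∃ C : ℝ, ∀ m, ∀ z ∈ (A m).charpoly.roots, ‖z‖ ≤ C := by
  let : NormedRing (Matrix (Fin n) (Fin n) ℂ) := Matrix.linftyOpNormedRing
  let : NormedAlgebra ℂ (Matrix (Fin n) (Fin n) ℂ) := Matrix.linftyOpNormedAlgebra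
  obtain ⟨C, hC⟩ := (Metric.isBounded_range_of_tendsto A hA).exists_norm_le
  refine ⟨C * ‖(1 : Matrix (Fin n) (Fin n) ℂ)‖, fun m z hz => ?_⟩
  have hz' : z ∈ spectrum ℂ (A m) :=
    Matrix.mem_spectrum_iff_isRoot_charpoly.2 (isRoot_of_mem_roots hz)
  exact (spectrum.norm_le_norm_mul_of_mem hz').trans
    (mul_le_mul_of_nonneg_right (hC _ ⟨m, rfl⟩) (norm_nonneg _))

/-- Along a subsequence, the eigenvalues of a convergent sequence of matrices can be numbered so
that they converge to the eigenvalues of the limit. -/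
theorem Matrix.exists_subseq_tendsto_roots_charpoly {n : ℕ} {A : ℕ → Matrix (Fin n) (Fin n) ℂ}
    {B : Matrix (Fin n) (Fin n) ℂ} (hA : Tendsto A atTop (𝓝 B)) :
    ∃ (φ : ℕ → ℕ) (r : ℕ → Fin n → ℂ) (s : Fin n → ℂ), Tendsto r atTop (𝓝 s) ∧
      StrictMono φ ∧
      (∀ m, (A (φ m)).charpoly.roots = Finset.univ.val.map (r m)) ∧
      B.charpoly.roots = Finset.univ.val.map s := by
  choose r hr using fun m => (A m).exists_charpoly_roots_eq_map
  obtain ⟨R, hR⟩ := Matrix.exists_norm_root_charpoly_le hA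
  have hmem : ∀ m, r m ∈ Metric.closedBall (0 : Fin n → ℂ) (max R 0) := fun m => by
    rw [mem_closedBall_zero_iff, pi_norm_le_iff_of_nonneg (le_max_right _ _)]
    refine fun i => (hR m _ ?_).trans (le_max_left _ _)
    rw [hr]
    exact Multiset.mem_map_of_mem _ (Finset.mem_univ_val i)
  obtain ⟨s, -, φ, hφ, hs⟩ := tendsto_subseq_of_bounded Metric.isBounded_closedBall hmem
  refine ⟨φ, r ∘ φ, s, hs, hφ, fun m => hr _, ?_⟩
  have hprod : ∀ m, (A m).charpoly = ∏ i, (X - C (r m i)) := fun m => by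
    rw [(IsAlgClosed.splits (A m).charpoly).eq_prod_roots_of_monic (A m).charpoly_monic, hr,
      Multiset.map_map]
    rfl
  have hB : B.charpoly = ∏ i, (X - C (s i)) := by
    refine Polynomial.funext fun z => ?_
    have h₁ : Tendsto (fun m => (A (φ m)).charpoly.eval z) atTop (𝓝 (B.charpoly.eval z)) := by
      simp only [Matrix.eval_charpoly]
      have hc : Continuous fun M : Matrix (Fin n) (Fin n) ℂ => (Matrix.scalar (Fin n) z - M).det :=
        (continuous_const.sub continuous_id).matrix_det
      exact (hc.tendsto B).comp (hA.comp hφ.tendsto_atTop)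
    refine tendsto_nhds_unique h₁ ?_
    simp only [hprod, eval_prod, eval_sub, eval_X, eval_C]
    exact tendsto_finsetProd _ fun i _ => tendsto_const_nhds.sub (tendsto_pi_nhds.1 hs i)
  have h := roots_multiset_prod_X_sub_C (Finset.univ.val.map s)
  rw [Multiset.map_map] at h
  rw [hB]
  exact h

open scoped Classical in
/-- The number of eigenvalues in the open right half-plane is continuous at every matrix without
eigenvalues on the imaginary axis. -/
theorem Matrix.continuousAt_card_roots_charpoly_re_pos {n : ℕ} {B : Matrix (Fin n) (Fin n) ℂ}
    (hB : ∀ z ∈ B.charpoly.roots, z.re ≠ 0) :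
    ContinuousAt (fun M : Matrix (Fin n) (Fin n) ℂ =>
      (M.charpoly.roots.filter (· ∈ {μ : ℂ | 0 < μ.re})).card) B := by
  have : FirstCountableTopology (Matrix (Fin n) (Fin n) ℂ) :=
    inferInstanceAs (FirstCountableTopology (Fin n → Fin n → ℂ))
  refine tendsto_of_seq_tendsto fun A hA => tendsto_of_subseq_tendsto fun ψ hψ => ?_
  obtain ⟨φ, r, s, hs, -, hr, hBs⟩ := Matrix.exists_subseq_tendsto_roots_charpoly (hA.comp hψ)
  refine ⟨φ, tendsto_nhds_of_eventually_eq ?_⟩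
  have hsign : ∀ᶠ m in atTop, ∀ i, (0 < (r m i).re ↔ 0 < (s i).re) := by
    refine eventually_all.2 fun i => ?_
    have hi : Tendsto (fun m => (r m i).re) atTop (𝓝 (s i).re) :=
      (Complex.continuous_re.tendsto _).comp (tendsto_pi_nhds.1 hs i)
    have h0 : (s i).re ≠ 0 := hB _ (hBs ▸ Multiset.mem_map_of_mem _ (Finset.mem_univ_val i))
    rcases h0.lt_or_gt with h0 | h0
    · filter_upwards [hi.eventually_lt_const h0] with m hm
      exact iff_of_false hm.not_gt h0.not_gt
    · filter_upwards [hi.eventually_const_lt h0] with m hm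
      exact iff_of_true hm h0
  filter_upwards [hsign] with m hm
  have hrm : (A (ψ (φ m))).charpoly.roots = Finset.univ.val.map (r m) := hr m
  rw [Function.comp_apply, hrm, hBs, Multiset.filter_map, Multiset.filter_map, Multiset.card_map,
    Multiset.card_map]
  congr 1
  exact Multiset.filter_congr fun i _ => hm i

open scoped Classical in
theorem Matrix.finrank_biSup_ker_mulVecLin_sub_smul_pow {n : ℕ} (M : Matrix (Fin n) (Fin n) ℂ)
    (S : Set ℂ) :
    Module.finrank ℂ ↥(⨆ μ ∈ S,
      LinearMap.ker (((M.mulVecLin : Module.End ℂ (Fin n → ℂ)) - μ • 1) ^ n)) =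
        (M.charpoly.roots.filter (· ∈ S)).card := by
  rw [← Matrix.charpoly_mulVecLin, ← Module.End.finrank_biSup_maxGenEigenspace]
  have hsup : ⨆ μ ∈ S, LinearMap.ker (((M.mulVecLin : Module.End ℂ (Fin n → ℂ)) - μ • 1) ^ n) =
      ⨆ μ ∈ S, Module.End.maxGenEigenspace M.mulVecLin μ := by
    simp only [Module.End.maxGenEigenspace_eq_genEigenspace_finrank, Module.End.genEigenspace_nat,
      Module.finrank_fin_fun]
  rw [hsup]

/-- For a continuous family `A(τ)`, `τ ∈ [0,1]`, of matrices with no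
eigenvalues on the imaginary axis, the dimension of the positive spectral subspace
(the sum of generalized eigenspaces with eigenvalues of positive real part) is
independent of `τ`. -/
theorem positive_spectral_subspace_dim_constant (n : ℕ)
    (A : ℝ → Matrix (Fin n) (Fin n) ℂ) (hcont : ContinuousOn A (Set.Icc (0 : ℝ) 1))
    (h : ∀ τ ∈ Set.Icc (0 : ℝ) 1, ∀ μ : ℂ,
      Module.End.HasEigenvalue (Matrix.mulVecLin (A τ)) μ → μ.re ≠ 0) :
    ∀ τ₁ ∈ Set.Icc (0 : ℝ) 1, ∀ τ₂ ∈ Set.Icc (0 : ℝ) 1,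
      Module.finrank ℂ ↥
          (⨆ μ ∈ {μ : ℂ | 0 < μ.re},
            LinearMap.ker (((Matrix.mulVecLin (A τ₁) : Module.End ℂ (Fin n → ℂ)) - μ • 1) ^ n)) =
        Module.finrank ℂ ↥
          (⨆ μ ∈ {μ : ℂ | 0 < μ.re},
            LinearMap.ker (((Matrix.mulVecLin (A τ₂) : Module.End ℂ (Fin n → ℂ)) - μ • 1) ^ n)) := by
  classical
  intro τ₁ h₁ τ₂ h₂
  rw [Matrix.finrank_biSup_ker_mulVecLin_sub_smul_pow,
    Matrix.finrank_biSup_ker_mulVecLin_sub_smul_pow]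
  have hroots : ∀ τ ∈ Set.Icc (0 : ℝ) 1, ∀ z ∈ (A τ).charpoly.roots, z.re ≠ 0 := fun τ hτ z hz =>
    h τ hτ z <| (Module.End.hasEigenvalue_iff_isRoot_charpoly _ _).2 <| by
      rw [Matrix.charpoly_mulVecLin]
      exact isRoot_of_mem_roots hz
  exact isPreconnected_Icc.constant (f := fun τ =>
    ((A τ).charpoly.roots.filter (· ∈ {μ : ℂ | 0 < μ.re})).card)
    (fun τ hτ =>
      (Matrix.continuousAt_card_roots_charpoly_re_pos (hroots τ hτ)).comp_continuousWithinAt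
        (hcont τ hτ)) h₁ h₂
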